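/- (Correctness of leaf-node removal.) Let ⊤ be a t-norm, let D_x, D_y, Z be finite nonempty sets, let S : D_x × D_y → [0,1] be the truth values of the unique atom incident to a leaf variable y, let μ_x : D_x → [0,1] and μ_y : D_y → [0,1] be the fuzzy vectors of x and y, and let F : D_x × Z → [0,1] be the aggregated truth value of the rest of the query (which does not depend on y). Then max_{(x,y,z) ∈ D_x × D_y × Z} ( μ_x(x) ⊤ μ_y(y) ⊤ S(x,y) ⊤ F(x,z) ) = max_{(x,z) ∈ D_x × Z} ( μ'_x(x) ⊤ F(x,z) ), where μ'_x(x) = μ_x(x) ⊤ max_{y ∈ D_y} ( μ_y(y) ⊤ S(x,y) ). Hence the leaf variable y can be eliminated by updating the fuzzy vector of x without changing the optimum. -/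

import Mathlib

open unitInterval

/-- correctness of leaf-node removal.  A leaf variable `y` can be
eliminated by absorbing `max_{y} (μ_y(y) ⊤ S(x,y))` into the fuzzy vector of
`x` without changing the optimum. -/
theorem remove_leaf_node_correct
    (T : I → I → I)
    (hcomm : ∀ a b : I, T a b = T b a)
    (hmono : ∀ a b c : I, a ≤ c → T a b ≤ T c b)
    (hassoc : ∀ a b c : I, T (T a b) c = T a (T b c))
    (hneut : ∀ a : I, T a 1 = a)
    (Dx Dy Z : Type*) [Fintype Dx] [Nonempty Dx] [Fintype Dy] [Nonempty Dy]
    [Fintype Z] [Nonempty Z]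
    (S : Dx → Dy → I) (μx : Dx → I) (μy : Dy → I) (F : Dx → Z → I) :
    Finset.univ.sup' Finset.univ_nonempty
        (fun p : Dx × Dy × Z =>
          T (μx p.1) (T (μy p.2.1) (T (S p.1 p.2.1) (F p.1 p.2.2)))) =
      Finset.univ.sup' Finset.univ_nonempty
        (fun p : Dx × Z =>
          T (T (μx p.1)
              (Finset.univ.sup' Finset.univ_nonempty (fun y => T (μy y) (S p.1 y))))
            (F p.1 p.2)) := by
  have hright : ∀ a b c : I, b ≤ c → T a b ≤ T a c := fun a b c h => by
    rw [hcomm a b, hcomm a c]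
    exact hmono b a c h
  apply le_antisymm
  · refine Finset.sup'_le _ _ fun ⟨x, y, z⟩ _ => ?_
    refine le_trans ?_ (Finset.le_sup' _ (Finset.mem_univ (x, z)))
    dsimp only
    rw [← hassoc (μy y), ← hassoc (μx x)]
    exact hmono _ _ _ (hright _ _ _
      (Finset.le_sup' (fun y => T (μy y) (S x y)) (Finset.mem_univ y)))
  · refine Finset.sup'_le _ _ fun ⟨x, z⟩ _ => ?_
    obtain ⟨y, -, hy⟩ := Finset.exists_mem_eq_sup' Finset.univ_nonempty
      (fun y => T (μy y) (S x y))
    simp only [hy, hassoc]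
    exact Finset.le_sup' (fun p : Dx × Dy × Z =>
      T (μx p.1) (T (μy p.2.1) (T (S p.1 p.2.1) (F p.1 p.2.2)))) (Finset.mem_univ (x, y, z))
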